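/- Let n be an odd positive integer and let S be a set of integers with S ⊆ {i : i odd, 0 < i < n/3} ∪ {i : i ≡ n (mod 4), 0 < i < n}. Let F(x) = x^n + Σ_{i∈S} x^i + 1 ∈ Z[x] and let G(x) = n·(n·F(x) − x·F'(x)). Then the resultant R(F, G), computed treating G as a polynomial of degree n − 4 (padding with leading zero coefficients as needed), is congruent to 1 modulo 8. -/

import Mathlib

open Polynomial

/-- The Sylvester matrix of `f` (of formal degree `n`) and `g` (of formal degree `m`):
the first `m` rows contain the coefficients of `f` and the remaining `n` rows contain
the coefficients of `g`, as in van der Waerden. -/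
noncomputable def sylvesterMatrix (n m : ℕ) (f g : Polynomial ℤ) :
    Matrix (Fin (m + n)) (Fin (m + n)) ℤ :=
  Matrix.of fun i j =>
    if (i : ℕ) < m then
      (if (i : ℕ) ≤ (j : ℕ) ∧ (j : ℕ) ≤ (i : ℕ) + n then f.coeff ((i : ℕ) + n - (j : ℕ))
       else 0)
    else
      (if (i : ℕ) - m ≤ (j : ℕ) ∧ (j : ℕ) ≤ (i : ℕ) then g.coeff ((i : ℕ) - (j : ℕ))
       else 0)

/-- The resultant `R(f, g)` of `f` (formal degree `n`) and `g` (formal degree `m`),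
defined as the determinant of the Sylvester matrix. -/
noncomputable def res (n m : ℕ) (f g : Polynomial ℤ) : ℤ := (sylvesterMatrix n m f g).det

theorem res_eq_resultant (n m : ℕ) (f g : ℤ[X]) : res n m f g = resultant f g n m := by
  rw [res, resultant, ← Matrix.det_transpose (sylvester f g n m),
    ← Matrix.det_submatrix_equiv_self (Fin.revPerm.trans (finCongr (add_comm m n)))]
  congr 1
  ext i j
  simp only [sylvesterMatrix, sylvester, Matrix.of_apply, Matrix.transpose_apply,
    Matrix.submatrix_apply, Equiv.trans_apply, Fin.revPerm_apply, finCongr_apply]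
  have hi := i.isLt
  have hj := j.isLt
  obtain ⟨k, hk⟩ : ∃ k, k = Fin.cast (add_comm m n) i.rev := ⟨_, rfl⟩
  have hkv : (k : ℕ) = m + n - (i + 1) := by simp [hk]
  rw [← hk]
  clear hk
  induction k using Fin.addCases with
  | left k =>
    have hlt := k.isLt
    simp only [Fin.addCases_left, Fin.val_castAdd, Fin.val_cast, Fin.val_rev, Set.mem_Icc]
      at hkv ⊢
    rw [if_neg (by omega)]
    split_ifs <;> first | omega | rfl | (congr 1; omega)
  | right k =>
    have hlt := k.isLt
    simp only [Fin.addCases_right, Fin.val_natAdd, Fin.val_cast, Fin.val_rev, Set.mem_Icc]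
      at hkv ⊢
    rw [if_pos (by omega)]
    split_ifs <;> first | omega | rfl | (congr 1; omega)

theorem prod_one_add_two_mul_add_four_mul_add_eight_mul {R ι : Type*} [CommRing R]
    (s : Finset ι) (a b c : ι → R) :
    ∃ e z : R, ∏ i ∈ s, (1 + 2 * a i + 4 * b i + 8 * c i) =
        1 + 2 * ∑ i ∈ s, a i + 4 * ∑ i ∈ s, b i + 4 * e + 8 * z ∧
      (∑ i ∈ s, a i) ^ 2 = ∑ i ∈ s, a i ^ 2 + 2 * e := by
  classical
  induction s using Finset.induction with
  | empty => exact ⟨0, 0, by simp⟩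
  | insert j s hj ih =>
    obtain ⟨e, z, h1, h2⟩ := ih
    simp only [Finset.prod_insert hj, Finset.sum_insert hj, h1]
    set A := ∑ i ∈ s, a i
    set B := ∑ i ∈ s, b i
    refine ⟨e + a j * A, z * (1 + 2 * a j + 4 * b j + 8 * c j) + a j * B + a j * e + b j * A
      + 2 * b j * B + 2 * b j * e + c j * (1 + 2 * A + 4 * B + 4 * e), ?_, ?_⟩
    · ring
    · linear_combination h2

/-- If the elementary symmetric functions of the family `r` of degrees in `[1, N]` vanish outside
the multiples of `d`, then so do its power sums. -/
theorem sum_pow_eq_zero_of_esymm_eq_zero {R σ : Type*} [CommRing R] [Fintype σ] (r : σ → R)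
    (d N : ℕ)
    (h : ∀ k ≤ N, ¬ d ∣ k → (Finset.univ.val.map r).esymm k = 0) (k : ℕ) (hk : k ≤ N)
    (hd : ¬ d ∣ k) : ∑ i, r i ^ k = 0 := by
  induction k using Nat.strong_induction_on with
  | _ k ih =>
    have hpos : 0 < k := Nat.pos_of_ne_zero fun h0 => hd (h0 ▸ dvd_zero d)
    have newton := congrArg (MvPolynomial.aeval r)
      (MvPolynomial.psum_eq_mul_esymm_sub_sum σ ℤ k hpos)
    simp only [MvPolynomial.psum, map_sum, map_pow, MvPolynomial.aeval_X, map_sub, map_mul,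
      MvPolynomial.aeval_esymm_eq_multiset_esymm, h k hk hd, mul_zero, zero_sub] at newton
    rw [newton, neg_eq_zero]
    refine Finset.sum_eq_zero fun a ha => ?_
    simp only [Finset.mem_filter, Finset.HasAntidiagonal.mem_antidiagonal, Set.mem_Ioo] at ha
    by_cases h1 : d ∣ a.1
    · rw [ih a.2 (by omega) (by omega) fun h2 => hd (ha.1 ▸ dvd_add h1 h2), mul_zero]
    · rw [h a.1 (by omega) h1, mul_zero, zero_mul]

theorem exists_prod_X_sub_C_eq_map_integralClosure {K : Type*} [Field K] [IsAlgClosed K]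
    (f : ℤ[X]) (hf : f.Monic) :
    ∃ t : Multiset (integralClosure ℤ K),
      f.map (algebraMap ℤ (integralClosure ℤ K)) = (t.map fun x => X - C x).prod := by
  have hs := (IsAlgClosed.splits (f.map (algebraMap ℤ K))).eq_prod_roots_of_monic (hf.map _)
  have hint : ∀ x ∈ (f.map (algebraMap ℤ K)).roots, x ∈ integralClosure ℤ K := by
    intro x hx
    refine ⟨f, hf, ?_⟩
    rw [← eval_map]
    exact isRoot_of_mem_roots hx
  obtain ⟨t, ht⟩ : ∃ t : Multiset (integralClosure ℤ K),
      t.map (algebraMap (integralClosure ℤ K) K) = (f.map (algebraMap ℤ K)).roots :=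
    ⟨(f.map (algebraMap ℤ K)).roots.attach.map fun x => ⟨x.1, hint x.1 x.2⟩, by
      rw [Multiset.map_map]; exact Multiset.attach_map_val _⟩
  refine ⟨t, map_injective (algebraMap (integralClosure ℤ K) K) Subtype.val_injective ?_⟩
  rw [map_map, ← IsScalarTower.algebraMap_eq, hs, ← ht, Polynomial.map_multiset_prod,
    Multiset.map_map, Multiset.map_map]
  simp [Function.comp_def]

theorem dvd_of_algebraMap_dvd_integralClosure {K : Type*} [Field K] [CharZero K] {a b : ℤ}
    (h : algebraMap ℤ (integralClosure ℤ K) a ∣ algebraMap ℤ (integralClosure ℤ K) b) :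
    a ∣ b := by
  obtain ⟨z, hz⟩ := h
  replace hz := congrArg (algebraMap (integralClosure ℤ K) K) hz
  by_cases ha : a = 0
  · subst ha
    simpa using hz
  have hz' : (algebraMap ℚ K) ((b : ℚ) / a) = z := by
    have : (a : K) ≠ 0 := by exact_mod_cast ha
    simp only [algebraMap_int_eq, eq_intCast, map_mul, map_intCast, map_div₀] at hz ⊢
    rw [hz, mul_div_cancel_left₀ _ this]
    rfl
  have hq : IsIntegral ℤ ((b : ℚ) / a) := by
    rw [← isIntegral_algebraMap_iff (algebraMap ℚ K).injective, hz']
    exact z.2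
  obtain ⟨y, hy⟩ := IsIntegrallyClosed.algebraMap_eq_of_integral hq
  refine ⟨y, ?_⟩
  have : (a : ℚ) ≠ 0 := by exact_mod_cast ha
  rw [eq_div_iff this] at hy
  have hy' : (y : ℚ) * a = b := hy
  rw [mul_comm]
  exact_mod_cast hy'.symm

theorem exists_prod_X_sub_C_eq_map_and_dvd (f : ℤ[X]) (hf : f.Monic) :
    ∃ (R : Type) (_ : CommRing R) (_ : IsDomain R) (_ : CharZero R) (t : Multiset R),
      f.map (algebraMap ℤ R) = (t.map fun x => X - C x).prod ∧
        ∀ a b : ℤ, algebraMap ℤ R a ∣ algebraMap ℤ R b → a ∣ b := by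
  obtain ⟨K, _, _, _⟩ : ∃ (K : Type) (_ : Field K) (_ : CharZero K), IsAlgClosed K :=
    ⟨AlgebraicClosure ℚ, inferInstance, inferInstance, inferInstance⟩
  obtain ⟨t, ht⟩ := exists_prod_X_sub_C_eq_map_integralClosure (K := K) f hf
  exact ⟨integralClosure ℤ K, inferInstance, inferInstance, inferInstance, t, ht,
    fun a b => dvd_of_algebraMap_dvd_integralClosure⟩

theorem monic_and_natDegree_X_pow_add_sum_X_pow_add_one {n : ℕ} (hn : 0 < n) (S : Finset ℕ)
    (hS : ∀ i ∈ S, i < n) :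
    (X ^ n + (∑ i ∈ S, X ^ i) + 1 : ℤ[X]).Monic ∧
      (X ^ n + (∑ i ∈ S, X ^ i) + 1 : ℤ[X]).natDegree = n := by
  have hdeg : ((∑ i ∈ S, X ^ i) + 1 : ℤ[X]).degree < n := by
    refine (degree_add_le _ _).trans_lt (max_lt ?_ ?_)
    · refine (degree_sum_le _ _).trans_lt ((Finset.sup_lt_iff (WithBot.bot_lt_coe n)).2 ?_)
      intro i hi
      rw [degree_X_pow]
      exact Nat.cast_lt.2 (hS i hi)
    · rw [degree_one]
      exact_mod_cast hn
  rw [add_assoc]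
  exact ⟨monic_X_pow_add hdeg, natDegree_eq_of_degree_eq_some (by
    rw [degree_add_eq_left_of_degree_lt (by rwa [degree_X_pow]), degree_X_pow])⟩

theorem mul_C_mul_sub_X_mul_derivative (n : ℕ) (S : Finset ℕ) :
    C (n : ℤ) * (C (n : ℤ) * (X ^ n + (∑ i ∈ S, X ^ i) + 1) -
        X * derivative (X ^ n + (∑ i ∈ S, X ^ i) + 1)) =
      C ((n : ℤ) ^ 2) + ∑ i ∈ S, C ((n : ℤ) * (n - i)) * X ^ i := by
  have hX : ∀ k : ℕ, (X : ℤ[X]) * derivative (X ^ k) = C (k : ℤ) * X ^ k := by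
    intro k
    cases k with
    | zero => simp
    | succ k => rw [derivative_X_pow, Nat.add_sub_cancel, pow_succ]; simp; ring
  simp only [derivative_add, derivative_sum, derivative_one, mul_add, hX, Finset.mul_sum, mul_sub,
    mul_zero, C_mul, C_sub, C_pow, sub_mul, Finset.sum_sub_distrib]
  ring_nf

theorem eight_dvd_prod_sub_one {R σ : Type*} [CommRing R] [IsDomain R] [CharZero R] [Fintype σ]
    {n : ℕ} (hodd : Odd n) (S : Finset ℕ)
    (hS : ∀ i ∈ S, (Odd i ∧ 0 < i ∧ 3 * i < n) ∨ (i % 4 = n % 4 ∧ 0 < i ∧ i < n))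
    (r : σ → R)
    (hr : ∀ k, 0 < k → k < n → n - k ∉ S → (Finset.univ.val.map r).esymm k = 0) :
    (8 : R) ∣ ∏ j, ((n : R) ^ 2 + ∑ i ∈ S, (n : R) * (n - i) * r j ^ i) - 1 := by
  obtain ⟨m, hm⟩ := hodd
  have hp2 : ∀ k, k ≤ n - 1 → ¬ 2 ∣ k → ∑ j, r j ^ k = 0 := by
    apply sum_pow_eq_zero_of_esymm_eq_zero
    intro k hk hd
    refine hr k (by omega) (by omega) fun hmem => ?_
    rcases hS _ hmem with ⟨⟨l, hl⟩, -, -⟩ | h <;> omega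
  have hp4 : ∀ k, k ≤ (2 * n - 1) / 3 → ¬ 4 ∣ k → ∑ j, r j ^ k = 0 := by
    apply sum_pow_eq_zero_of_esymm_eq_zero
    intro k hk hd
    refine hr k (by omega) (by omega) fun hmem => ?_
    rcases hS _ hmem with h | h <;> omega
  have hSodd : ∀ i ∈ S, i % 2 = 1 ∧ i < n := by
    intro i hi
    rcases hS i hi with ⟨⟨l, hl⟩, h⟩ | h <;> omega
  set A := S.filter fun i => i % 4 ≠ n % 4 with hA
  set B := S.filter fun i => ¬ i % 4 ≠ n % 4 with hB
  have hAc : ∀ i : ℕ, ∃ c : R, i ∈ A → (n : R) * (n - i) = 2 * c := by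
    intro i
    by_cases hi : i ∈ A
    · have := hSodd i (Finset.mem_filter.1 hi).1
      obtain ⟨l, hl⟩ : ∃ l, n = i + 2 * l := ⟨(n - i) / 2, by omega⟩
      exact ⟨n * l, fun _ => by rw [hl]; push_cast; ring⟩
    · exact ⟨0, fun h => absurd h hi⟩
  have hBc : ∀ i : ℕ, ∃ c : R, i ∈ B → (n : R) * (n - i) = 4 * c := by
    intro i
    by_cases hi : i ∈ B
    · have h1 := hSodd i (Finset.mem_filter.1 hi).1
      have h2 := (Finset.mem_filter.1 hi).2
      obtain ⟨l, hl⟩ : ∃ l, n = i + 4 * l := ⟨(n - i) / 4, by omega⟩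
      exact ⟨n * l, fun _ => by rw [hl]; push_cast; ring⟩
    · exact ⟨0, fun h => absurd h hi⟩
  choose c hc using hAc
  choose d hd using hBc
  obtain ⟨q, hq⟩ : ∃ q : ℕ, n ^ 2 = 1 + 8 * q := by
    obtain ⟨q, hq⟩ := Nat.even_mul_succ_self m
    refine ⟨q, ?_⟩
    rw [hm]
    linear_combination 4 * hq
  have hq' : (n : R) ^ 2 = 1 + 8 * q := by exact_mod_cast hq
  have hfac : ∀ j, (n : R) ^ 2 + ∑ i ∈ S, (n : R) * (n - i) * r j ^ i =
      1 + 2 * (∑ i ∈ A, c i * r j ^ i) + 4 * (∑ i ∈ B, d i * r j ^ i) + 8 * q := by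
    intro j
    rw [← Finset.sum_filter_add_sum_filter_not S (fun i => i % 4 ≠ n % 4), hq', Finset.mul_sum,
      Finset.mul_sum, Finset.sum_congr rfl fun i hi => by rw [hc i hi, mul_assoc],
      Finset.sum_congr (s₁ := S.filter fun i => ¬ i % 4 ≠ n % 4) rfl
        fun i hi => by rw [hd i hi, mul_assoc]]
    ring
  have htrace : ∀ (T : Finset ℕ) (u : ℕ → R), T ⊆ S →
      ∑ j, ∑ i ∈ T, u i * r j ^ i = 0 := by
    intro T u hT
    rw [Finset.sum_comm]
    refine Finset.sum_eq_zero fun i hi => ?_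
    have := hSodd i (hT hi)
    rw [← Finset.mul_sum, hp2 i (by omega) (by omega), mul_zero]
  have hsq : ∑ j, (∑ i ∈ A, c i * r j ^ i) ^ 2 = 0 := by
    simp only [sq, Finset.sum_mul_sum]
    rw [Finset.sum_comm]
    refine Finset.sum_eq_zero fun i hi => ?_
    rw [Finset.sum_comm]
    refine Finset.sum_eq_zero fun i' hi' => ?_
    have hbound : ∀ l ∈ A, l % 4 = (n + 2) % 4 ∧ 3 * l < n := by
      intro l hl
      obtain ⟨hl1, hl2⟩ := Finset.mem_filter.1 hl
      have := hSodd l hl1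
      rcases hS l hl1 with h | h <;> omega
    have h1 := hbound i hi
    have h2 := hbound i' hi'
    rw [Finset.sum_congr rfl fun j _ =>
      show c i * r j ^ i * (c i' * r j ^ i') = c i * c i' * r j ^ (i + i') by ring,
      ← Finset.mul_sum, hp4 (i + i') (by omega) (by omega), mul_zero]
  obtain ⟨e, z, h1, h2⟩ := prod_one_add_two_mul_add_four_mul_add_eight_mul Finset.univ
    (fun j => ∑ i ∈ A, c i * r j ^ i) (fun j => ∑ i ∈ B, d i * r j ^ i) (fun _ => (q : R))
  rw [htrace A c (Finset.filter_subset _ _), hsq] at h2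
  have he : e = 0 := by
    have : (2 : R) * e = 0 := by linear_combination -h2
    simpa using this
  refine ⟨z, ?_⟩
  rw [Finset.prod_congr rfl fun j _ => hfac j, h1, htrace A c (Finset.filter_subset _ _),
    htrace B d (Finset.filter_subset _ _), he]
  ring

/-- Let `n` be odd, `F = x^n + ∑_{i ∈ S} x^i + 1 ∈ ℤ[x]` (with `S` as in the main
theorem) and `G = n·(n·F - x·F')`.  Then the resultant `R(F, G)`, computed treating `G`
as a polynomial of formal degree `n - 4` (padding with leading zero coefficients as
needed), is `≡ 1 (mod 8)`. -/
theorem resultant_F_G_mod_eight (n : ℕ) (hodd : Odd n) (hpos : 0 < n)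
    (S : Finset ℕ)
    (hS : ∀ i ∈ S, (Odd i ∧ 0 < i ∧ 3 * i < n) ∨ (i % 4 = n % 4 ∧ 0 < i ∧ i < n))
    (F : Polynomial ℤ) (hF : F = X ^ n + (∑ i ∈ S, X ^ i) + 1)
    (G : Polynomial ℤ)
    (hG : G = C (n : ℤ) * (C (n : ℤ) * F - X * Polynomial.derivative F)) :
    res n (n - 4) F G ≡ 1 [ZMOD 8] := by
  classical
  obtain ⟨hmonic, hdeg⟩ := monic_and_natDegree_X_pow_add_sum_X_pow_add_one hpos S fun i hi => by
    rcases hS i hi with h | h <;> omega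
  rw [hF, mul_C_mul_sub_X_mul_derivative] at hG
  rw [← hF] at hmonic hdeg
  have hGdeg : G.natDegree ≤ n - 4 := by
    rw [hG]
    refine natDegree_add_le_of_degree_le (by simp) (natDegree_sum_le_of_forall_le _ _ ?_)
    intro i hi
    refine (natDegree_C_mul_X_pow_le _ _).trans ?_
    rcases hS i hi with ⟨⟨l, hl⟩, h⟩ | h
    · obtain ⟨m, hm⟩ := hodd
      omega
    · omega
  obtain ⟨R, _, _, _, t, ht, hdvd⟩ := exists_prod_X_sub_C_eq_map_and_dvd F hmonic
  have hroots : (F.map (algebraMap ℤ R)).roots = t := by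
    rw [ht, roots_multiset_prod_X_sub_C]
  have hFdeg : (F.map (algebraMap ℤ R)).natDegree = n := by rw [hmonic.natDegree_map, hdeg]
  have hcard : Multiset.card t = n := by
    rw [← hFdeg, ht, natDegree_multiset_prod_X_sub_C_eq_card]
  have hsplits : (F.map (algebraMap ℤ R)).Splits := by
    rw [splits_iff_card_roots, hroots, hcard, hFdeg]
  have hres : algebraMap ℤ R (resultant F G n (n - 4)) =
      (t.map (G.map (algebraMap ℤ R)).eval).prod := by
    have := resultant_eq_prod_eval (F.map (algebraMap ℤ R)) (G.map (algebraMap ℤ R)) (n - 4)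
      (natDegree_map_le.trans hGdeg) hsplits
    rwa [hFdeg, resultant_map_map, hroots, (hmonic.map _).leadingCoeff, one_pow, one_mul] at this
  have hesymm : ∀ k, 0 < k → k < n → n - k ∉ S → t.esymm k = 0 := by
    intro k hk hkn hkS
    have := t.prod_X_sub_C_coeff (k := n - k) (by omega)
    rw [← ht, hcard, Nat.sub_sub_self hkn.le, coeff_map] at this
    have hcoeff : F.coeff (n - k) = 0 := by
      rw [hF]
      simp [coeff_X_pow, coeff_one, hkS]
      omega
    rw [hcoeff, map_zero] at this
    simpa using this.symm
  rw [res_eq_resultant, Int.modEq_comm, Int.modEq_iff_dvd]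
  apply hdvd
  have hmap : Finset.univ.val.map (fun x : t => (x.1 : R)) = t := t.map_univ_coe
  have key := eight_dvd_prod_sub_one hodd S hS (fun x : t => (x.1 : R)) (by rwa [hmap])
  rw [map_sub, hres, map_one]
  convert key using 2
  · simp
  · conv_lhs => rw [← hmap, Multiset.map_map]
    refine Finset.prod_congr rfl fun x _ => ?_
    simp [hG, eval_finsetSum, Polynomial.map_sum]
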